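/- For every integer n ≥ 1 there exist constants δ₀ > 0, C > 0 and c > 0 such that the following holds: for every ε > 0, every R > 0, every r > 0 with 2 ≤ R/r ≤ 8, and every smooth u : ℝ² → ℝ^{n+1} satisfying −Δu = (1/ε²)(1−|u|²)u on the open annulus B_{2R} \ closure(B_{R/16}) with |u| ≤ 1 there and ∫_{B_{2R}\B_{R/16}} e_ε(u) < δ₀, one has for every σ > 0: ∫_{B_R\B_r} |u|·(1−|u|²)²/ε² ≤ σ·( ∫_{B_{2R}\B_{R/16}} e_ε(u) + C(R²/ε²)e^{−cR/ε} )² + (C/(σR²))·∫_{B_R\B_r} (1−|u|²)². -/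

import Mathlib

open MeasureTheory Metric Real

noncomputable section

/-- Euclidean plane. -/
abbrev E2 : Type := EuclideanSpace ℝ (Fin 2)

/-- Partial derivative in the `k`-th coordinate direction. -/
def pd {F : Type} [NormedAddCommGroup F] [NormedSpace ℝ F]
    (k : Fin 2) (f : E2 → F) (x : E2) : F :=
  fderiv ℝ f x (EuclideanSpace.single k 1)

/-- Euclidean Laplacian, acting componentwise. -/
def lap {F : Type} [NormedAddCommGroup F] [NormedSpace ℝ F]
    (f : E2 → F) (x : E2) : F :=
  pd 0 (pd 0 f) x + pd 1 (pd 1 f) x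

/-- Squared Frobenius norm of the total derivative. -/
def gradSqNorm {F : Type} [NormedAddCommGroup F] [NormedSpace ℝ F]
    (f : E2 → F) (x : E2) : ℝ :=
  ∑ k : Fin 2, ‖pd k f x‖ ^ 2

/-- Ginzburg–Landau energy density `e_ε(u) = ½|Du|² + (1−|u|²)²/(4ε²)`. -/
def eDens {F : Type} [NormedAddCommGroup F] [NormedSpace ℝ F]
    (ε : ℝ) (f : E2 → F) (x : E2) : ℝ :=
  gradSqNorm f x / 2 + (1 - ‖f x‖ ^ 2) ^ 2 / (4 * ε ^ 2)

lemma pd_smooth {F : Type} [NormedAddCommGroup F] [NormedSpace ℝ F] {f : E2 → F}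
    (hf : ContDiff ℝ (⊤ : ℕ∞) f) (k : Fin 2) : ContDiff ℝ (⊤ : ℕ∞) (pd k f) := by
  unfold pd
  exact (hf.fderiv_right (m := ((⊤ : ℕ∞) : WithTop ℕ∞)) (by simp)).clm_apply contDiff_const

lemma smooth_diff {F : Type} [NormedAddCommGroup F] [NormedSpace ℝ F] {f : E2 → F}
    (hf : ContDiff ℝ (⊤ : ℕ∞) f) : Differentiable ℝ f := hf.differentiable (by simp)

lemma pd_mul {f g : E2 → ℝ} (hf : Differentiable ℝ f) (hg : Differentiable ℝ g) (k : Fin 2)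
    (x : E2) : pd k (fun y => f y * g y) x = f x * pd k g x + pd k f x * g x := by
  unfold pd
  rw [fderiv_fun_mul (hf x) (hg x)]
  simp [mul_comm]

lemma pd_add {F : Type} [NormedAddCommGroup F] [NormedSpace ℝ F] {f g : E2 → F}
    (hf : Differentiable ℝ f) (hg : Differentiable ℝ g) (k : Fin 2)
    (x : E2) : pd k (fun y => f y + g y) x = pd k f x + pd k g x := by
  unfold pd
  rw [fderiv_fun_add (hf x) (hg x)]
  simp

lemma pd_sub {F : Type} [NormedAddCommGroup F] [NormedSpace ℝ F] {f g : E2 → F}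
    (hf : Differentiable ℝ f) (hg : Differentiable ℝ g) (k : Fin 2)
    (x : E2) : pd k (fun y => f y - g y) x = pd k f x - pd k g x := by
  unfold pd
  rw [fderiv_fun_sub (hf x) (hg x)]
  simp

lemma pd_const (c : ℝ) (k : Fin 2) (x : E2) : pd k (fun _ : E2 => c) x = 0 := by
  unfold pd; simp

lemma pd_smul {F : Type} [NormedAddCommGroup F] [NormedSpace ℝ F] {f : E2 → ℝ} {g : E2 → F}
    (hf : Differentiable ℝ f) (hg : Differentiable ℝ g) (k : Fin 2)
    (x : E2) : pd k (fun y => f y • g y) x = f x • pd k g x + pd k f x • g x := by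
  unfold pd
  rw [fderiv_fun_smul (hf x) (hg x)]
  simp

lemma pd_inner {F : Type} [NormedAddCommGroup F] [InnerProductSpace ℝ F] {f g : E2 → F}
    (hf : Differentiable ℝ f) (hg : Differentiable ℝ g) (k : Fin 2)
    (x : E2) : pd k (fun y => inner ℝ (f y) (g y)) x
      = inner ℝ (f x) (pd k g x) + inner ℝ (pd k f x) (g x) := by
  unfold pd
  rw [fderiv_inner_apply ℝ (hf x) (hg x)]

lemma pd_normsq {F : Type} [NormedAddCommGroup F] [InnerProductSpace ℝ F] {f : E2 → F}
    (hf : Differentiable ℝ f) (k : Fin 2)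
    (x : E2) : pd k (fun y => ‖f y‖ ^ 2) x = 2 * inner ℝ (f x) (pd k f x) := by
  have : (fun y => ‖f y‖ ^ 2) = fun y => inner ℝ (f y) (f y) := by
    funext y; rw [real_inner_self_eq_norm_sq]
  rw [this, pd_inner hf hf, real_inner_comm (pd k f x)]
  ring

lemma pd_comm {F : Type} [NormedAddCommGroup F] [NormedSpace ℝ F] {f : E2 → F}
    (hf : ContDiff ℝ (⊤ : ℕ∞) f) (j k : Fin 2) (x : E2) :
    pd j (pd k f) x = pd k (pd j f) x := by
  have h2 : ContDiff ℝ 2 f := contDiff_infty.1 hf 2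
  have hd : DifferentiableAt ℝ (fderiv ℝ f) x :=
    (h2.fderiv_right (m := 1) (by norm_num)).differentiable (by norm_num) x
  have key : ∀ i l : Fin 2, pd i (pd l f) x
      = fderiv ℝ (fderiv ℝ f) x (EuclideanSpace.single i 1) (EuclideanSpace.single l 1) := by
    intro i l
    unfold pd
    rw [fderiv_clm_apply hd (by fun_prop)]
    simp
  rw [key, key]
  exact (h2.contDiffAt.isSymmSndFDerivAt (by simp)).eq _ _

lemma pd_eqOn {F : Type} [NormedAddCommGroup F] [NormedSpace ℝ F] {f g : E2 → F} {A : Set E2}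
    (hA : IsOpen A) (h : ∀ x ∈ A, f x = g x) (k : Fin 2) {x : E2} (hx : x ∈ A) :
    pd k f x = pd k g x := by
  unfold pd
  rw [Filter.EventuallyEq.fderiv_eq]
  filter_upwards [hA.mem_nhds hx] with y hy using h y hy

lemma tsupport_pd {F : Type} [NormedAddCommGroup F] [NormedSpace ℝ F] (f : E2 → F) (k : Fin 2) :
    tsupport (pd k f) ⊆ tsupport f := by
  refine (closure_minimal ?_ (isClosed_tsupport f))
  intro x hx
  refine support_fderiv_subset ℝ (f := f) ?_
  intro h0
  apply hx
  simp [pd, h0]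

lemma pd_zero_of_notMem {F : Type} [NormedAddCommGroup F] [NormedSpace ℝ F] {f : E2 → F}
    {A : Set E2} (hA : tsupport f ⊆ A) (k : Fin 2) {x : E2} (hx : x ∉ A) : pd k f x = 0 := by
  by_contra h
  exact hx (hA (tsupport_pd f k (subset_tsupport _ h)))

lemma zero_of_notMem {F : Type} [NormedAddCommGroup F] {f : E2 → F}
    {A : Set E2} (hA : tsupport f ⊆ A) {x : E2} (hx : x ∉ A) : f x = 0 := by
  by_contra h
  exact hx (hA (subset_tsupport _ h))

lemma int_of_cont {A : Set E2} (hA : Bornology.IsBounded A) {f : E2 → ℝ} (hf : Continuous f) :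
    Integrable f (volume.restrict A) := by
  have : IntegrableOn f (closure A) volume :=
    hf.continuousOn.integrableOn_compact hA.isCompact_closure
  exact this.mono_set subset_closure

lemma integral_pd {A : Set E2} (hA : Bornology.IsBounded A) {f : E2 → ℝ}
    (hf : ContDiff ℝ (⊤ : ℕ∞) f) (hs : tsupport f ⊆ A) (k : Fin 2) :
    ∫ x in A, pd k f x = 0 := by
  have hc : HasCompactSupport f := hA.isCompact_closure.of_isClosed_subset
    (isClosed_tsupport f) (hs.trans subset_closure)
  have hc' : HasCompactSupport (pd k f) := hc.of_isClosed_subset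
    (isClosed_tsupport _) (tsupport_pd f k)
  rw [setIntegral_eq_integral_of_forall_compl_eq_zero
    (fun x hx => pd_zero_of_notMem hs k hx)]
  have h := integral_mul_fderiv_eq_neg_fderiv_mul_of_integrable (μ := (volume : Measure E2))
    (f := fun _ : E2 => (1:ℝ)) (g := f) (v := EuclideanSpace.single k 1)
    (by simp)
    (by simp only [one_mul]; exact (pd_smooth hf k).continuous.integrable_of_hasCompactSupport hc')
    (by simpa using hf.continuous.integrable_of_hasCompactSupport hc)
    (fun x _ => by fun_prop) (fun x _ => smooth_diff hf x)
  simpa [pd] using h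

lemma cs_ineq {A : Set E2} (hA : Bornology.IsBounded A) {f g : E2 → ℝ}
    (hf : Continuous f) (hg : Continuous g) :
    (∫ x in A, f x * g x) ^ 2 ≤ (∫ x in A, f x ^ 2) * ∫ x in A, g x ^ 2 := by
  have hq : ∀ t : ℝ, 0 ≤ (∫ x in A, f x ^ 2) * (t * t) + (2 * ∫ x in A, f x * g x) * t
      + ∫ x in A, g x ^ 2 := by
    intro t
    have : (∫ x in A, f x ^ 2) * (t * t) + (2 * ∫ x in A, f x * g x) * t
      + ∫ x in A, g x ^ 2 = ∫ x in A, (f x * t + g x) ^ 2 := by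
      have e : ∀ x, (f x * t + g x) ^ 2 = f x ^ 2 * (t * t) + (f x * g x) * (2 * t) + g x ^ 2 := by
        intro x; ring
      simp_rw [e]
      rw [integral_add, integral_add, integral_mul_const, integral_mul_const]
      · ring
      all_goals exact int_of_cont hA (by fun_prop)
    rw [this]
    exact integral_nonneg fun x => sq_nonneg _
  have := discrim_le_zero hq
  unfold discrim at this
  nlinarith

lemma gns : ∃ C > (0:ℝ), ∀ (A : Set E2), Bornology.IsBounded A → ∀ g : E2 → ℝ,
    ContDiff ℝ (⊤ : ℕ∞) g → tsupport g ⊆ A →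
    ∫ x in A, g x ^ 2 ≤ C * (∫ x in A, (|pd 0 g x| + |pd 1 g x|)) ^ 2 := by
  obtain ⟨C, hC⟩ : ∃ C : NNReal, C = eLpNormLESNormFDerivOneConst (volume : Measure E2) ((2 : NNReal) : ℝ) :=
    ⟨_, rfl⟩
  refine ⟨(C:ℝ)^2 + 1, by positivity, ?_⟩
  intro A hA g hg hs
  have hc : HasCompactSupport g := hA.isCompact_closure.of_isClosed_subset
    (isClosed_tsupport g) (hs.trans subset_closure)
  have hc' : ∀ k, HasCompactSupport (pd k g) := fun k => hc.of_isClosed_subset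
    (isClosed_tsupport _) (tsupport_pd g k)
  have h1 : ContDiff ℝ 1 g := contDiff_infty.1 hg 1
  have h := eLpNorm_le_eLpNorm_fderiv_one (μ := (volume : Measure E2)) h1 hc (p := 2)
    (by simp; exact NNReal.HolderConjugate.two_two)
  rw [← hC] at h
  rw [ENNReal.coe_ofNat] at h
  have hfi : Integrable (fderiv ℝ g) volume :=
    (h1.continuous_fderiv (by norm_num)).integrable_of_hasCompactSupport (hc.fderiv ℝ)
  have hm : MemLp g 2 volume := hg.continuous.memLp_of_hasCompactSupport hc
  have h1' : ∫ x, ‖fderiv ℝ g x‖ ≤ ∫ x in A, (|pd 0 g x| + |pd 1 g x|) := by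
    rw [setIntegral_eq_integral_of_forall_compl_eq_zero (fun x hx => by
      simp [pd_zero_of_notMem hs _ hx])]
    refine integral_mono hfi.norm ?_ ?_
    · exact (((pd_smooth hg 0).continuous.integrable_of_hasCompactSupport (hc' 0)).abs).add
        (((pd_smooth hg 1).continuous.integrable_of_hasCompactSupport (hc' 1)).abs)
    · intro x
      refine ContinuousLinearMap.opNorm_le_bound _ (by positivity) ?_
      intro v
      have hv : v = v 0 • EuclideanSpace.single 0 1 + v 1 • EuclideanSpace.single 1 1 := by
        ext i; fin_cases i <;> simp
      have e : fderiv ℝ g x v = v 0 * pd 0 g x + v 1 * pd 1 g x := by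
        conv_lhs => rw [hv]
        simp [pd]
      rw [e]
      have h0 := PiLp.norm_apply_le v 0
      have h1 := PiLp.norm_apply_le v 1
      rw [Real.norm_eq_abs] at *
      calc |v 0 * pd 0 g x + v 1 * pd 1 g x| ≤ |v 0| * |pd 0 g x| + |v 1| * |pd 1 g x| := by
            rw [← abs_mul, ← abs_mul]; exact abs_add_le _ _
        _ ≤ ‖v‖ * |pd 0 g x| + ‖v‖ * |pd 1 g x| := by gcongr
        _ = _ := by ring
  have h2 : ∫ x in A, g x ^ 2 = (eLpNorm g 2 volume).toReal ^ 2 := by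
    rw [setIntegral_eq_integral_of_forall_compl_eq_zero (fun x hx => by
      simp [zero_of_notMem hs hx])]
    rw [hm.eLpNorm_eq_integral_rpow_norm (by norm_num) (by norm_num)]
    have hp : 0 ≤ ∫ x, g x ^ 2 := integral_nonneg fun x => sq_nonneg _
    have : ∫ a, ‖g a‖ ^ (2:ENNReal).toReal = ∫ x, g x ^ 2 := by simp
    rw [this, ENNReal.toReal_ofReal (by positivity)]
    simp only [ENNReal.toReal_ofNat]
    rw [← Real.rpow_natCast, ← Real.rpow_mul hp]; norm_num
  have h3 : (eLpNorm g 2 volume).toReal ≤ C * ∫ x, ‖fderiv ℝ g x‖ := by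
    rw [integral_norm_eq_lintegral_enorm hfi.aestronglyMeasurable, ← eLpNorm_one_eq_lintegral_enorm]
    have := ENNReal.toReal_mono (ENNReal.mul_ne_top (by simp) (memLp_one_iff_integrable.2 hfi).2.ne) h
    simpa using this
  rw [h2]
  have h4 : 0 ≤ ∫ x, ‖fderiv ℝ g x‖ := integral_nonneg fun x => norm_nonneg _
  calc (eLpNorm g 2 volume).toReal ^ 2 ≤ (C * ∫ x in A, (|pd 0 g x| + |pd 1 g x|)) ^ 2 := by
        gcongr; exact h3.trans (by gcongr)
    _ ≤ _ := by nlinarith [sq_nonneg (∫ x in A, (|pd 0 g x| + |pd 1 g x|))]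

lemma exists_cutoff {K U : Set E2} (hK : IsCompact K) (hU : IsOpen U) (h : K ⊆ U) :
    ∃ f : E2 → ℝ, ContDiff ℝ (⊤ : ℕ∞) f ∧ HasCompactSupport f ∧ tsupport f ⊆ U ∧
      (∀ x ∈ K, f x = 1) ∧ ∀ x, f x ∈ Set.Icc (0:ℝ) 1 := by
  obtain ⟨L, hL, hKL, hLU⟩ := exists_compact_between hK hU h
  obtain ⟨f, hf1, hf0, hf⟩ := exists_contMDiffMap_one_nhds_of_subset_interior
    (n := (⊤ : ℕ∞)) (modelWithCornersSelf ℝ E2) hK.isClosed hKL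
  have hts : tsupport f ⊆ L := closure_minimal (fun x hx => by
    by_contra hn; exact hx (hf0 x hn)) hL.isClosed
  exact ⟨f, f.contMDiff.contDiff, hL.of_isClosed_subset (isClosed_tsupport _) hts,
    hts.trans hLU, fun x hx => hf1.self_of_nhdsSet x hx, hf⟩

lemma cs_bound {f : E2 → ℝ} (hf : Continuous f) (hc : HasCompactSupport f) :
    ∃ M > (0:ℝ), ∀ x, |f x| ≤ M := by
  obtain ⟨M, hM⟩ := hc.exists_bound_of_continuous hf
  exact ⟨|M| + 1, by positivity, fun x => by
    have := hM x; rw [Real.norm_eq_abs] at this; have := le_abs_self M; linarith⟩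

/-- The potential defect `1 - |u|²`. -/
def Wf {F : Type} [NormedAddCommGroup F] (u : E2 → F) (x : E2) : ℝ := 1 - ‖u x‖ ^ 2

/-- Squared norm of the Hessian. -/
def hessSq {F : Type} [NormedAddCommGroup F] [NormedSpace ℝ F] (u : E2 → F) (x : E2) : ℝ :=
  ∑ j : Fin 2, gradSqNorm (pd j u) x

section smooth
variable {F : Type} [NormedAddCommGroup F] [InnerProductSpace ℝ F] {u : E2 → F}

lemma Wf_smooth (hu : ContDiff ℝ (⊤ : ℕ∞) u) : ContDiff ℝ (⊤ : ℕ∞) (Wf u) := by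
  unfold Wf
  exact contDiff_const.sub (hu.norm_sq ℝ)

lemma gradSq_smooth (hu : ContDiff ℝ (⊤ : ℕ∞) u) : ContDiff ℝ (⊤ : ℕ∞) (gradSqNorm u) := by
  unfold gradSqNorm
  exact ContDiff.sum fun k _ => (pd_smooth hu k).norm_sq ℝ

lemma hessSq_smooth (hu : ContDiff ℝ (⊤ : ℕ∞) u) : ContDiff ℝ (⊤ : ℕ∞) (hessSq u) := by
  unfold hessSq
  exact ContDiff.sum fun k _ => gradSq_smooth (pd_smooth hu k)

lemma lap_smooth {F : Type} [NormedAddCommGroup F] [NormedSpace ℝ F] {u : E2 → F}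
    (hu : ContDiff ℝ (⊤ : ℕ∞) u) : ContDiff ℝ (⊤ : ℕ∞) (lap u) := by
  unfold lap
  exact (pd_smooth (pd_smooth hu 0) 0).add (pd_smooth (pd_smooth hu 1) 1)

lemma gradSq_nonneg {F : Type} [NormedAddCommGroup F] [NormedSpace ℝ F] (u : E2 → F) (x : E2) :
    0 ≤ gradSqNorm u x := by
  unfold gradSqNorm; positivity

lemma hessSq_nonneg {F : Type} [NormedAddCommGroup F] [NormedSpace ℝ F] (u : E2 → F) (x : E2) :
    0 ≤ hessSq u x := Finset.sum_nonneg fun _ _ => gradSq_nonneg _ _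

lemma gradSq_real (f : E2 → ℝ) (x : E2) : gradSqNorm f x = pd 0 f x ^ 2 + pd 1 f x ^ 2 := by
  simp [gradSqNorm]

lemma pd_Wf (hu : ContDiff ℝ (⊤ : ℕ∞) u) (k : Fin 2) (x : E2) :
    pd k (Wf u) x = (-2) * inner ℝ (u x) (pd k u x) := by
  have h := pd_sub (f := fun _ => (1:ℝ)) (g := fun y => ‖u y‖ ^ 2) (by fun_prop)
    (smooth_diff (hu.norm_sq ℝ)) k x
  rw [pd_const, pd_normsq (smooth_diff hu)] at h
  have e : Wf u = fun y => 1 - ‖u y‖ ^ 2 := rfl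
  rw [e, h]; ring

lemma lap_Wf {A : Set E2} {ε : ℝ} (hu : ContDiff ℝ (⊤ : ℕ∞) u)
    (hpde : ∀ x ∈ A, -lap u x = ((1 / ε ^ 2) * (1 - ‖u x‖ ^ 2)) • u x) {x : E2} (hx : x ∈ A) :
    lap (Wf u) x = -2 * gradSqNorm u x + 2 * (1 / ε ^ 2) * ‖u x‖ ^ 2 * Wf u x := by
  have key : ∀ k, pd k (pd k (Wf u)) x
      = (-2) * (inner ℝ (u x) (pd k (pd k u) x) + ‖pd k u x‖ ^ 2) := by
    intro k
    have e : pd k (Wf u) = fun y => (-2) * inner ℝ (u y) (pd k u y) := by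
      funext y; exact pd_Wf hu k y
    rw [e, pd_mul (f := fun _ => (-2:ℝ)) (by fun_prop)
      (smooth_diff (hu.inner ℝ (pd_smooth hu k))), pd_const,
      pd_inner (smooth_diff hu) (smooth_diff (pd_smooth hu k)), real_inner_self_eq_norm_sq]
    ring
  have h1 : inner ℝ (u x) (lap u x) = -((1 / ε ^ 2) * Wf u x) * ‖u x‖ ^ 2 := by
    have : lap u x = (-((1 / ε ^ 2) * Wf u x)) • u x := by
      rw [neg_smul, Wf, ← hpde x hx, neg_neg]
    rw [this, inner_smul_right, real_inner_self_eq_norm_sq]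
  rw [lap, inner_add_right] at h1
  rw [lap, key, key, gradSqNorm, Fin.sum_univ_two]
  linear_combination (-2) * h1

lemma lap_normsq (hu : ContDiff ℝ (⊤ : ℕ∞) u) (x : E2) :
    lap (fun y => ‖u y‖ ^ 2) x = 2 * gradSqNorm u x + 2 * inner ℝ (u x) (lap u x) := by
  have key : ∀ k, pd k (pd k (fun y => ‖u y‖ ^ 2)) x
      = 2 * (inner ℝ (u x) (pd k (pd k u) x) + ‖pd k u x‖ ^ 2) := by
    intro k
    have e : pd k (fun y => ‖u y‖ ^ 2) = fun y => 2 * inner ℝ (u y) (pd k u y) := by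
      funext y; exact pd_normsq (smooth_diff hu) k y
    rw [e, pd_mul (f := fun _ => (2:ℝ)) (by fun_prop)
      (smooth_diff (hu.inner ℝ (pd_smooth hu k))), pd_const,
      pd_inner (smooth_diff hu) (smooth_diff (pd_smooth hu k)), real_inner_self_eq_norm_sq]
    ring
  rw [lap, key, key, gradSqNorm, Fin.sum_univ_two, lap, inner_add_right]
  ring

lemma lap_pd (hu : ContDiff ℝ (⊤ : ℕ∞) u) (k : Fin 2) (x : E2) :
    lap (pd k u) x = pd k (lap u) x := by
  have h : ∀ j, pd j (pd j (pd k u)) x = pd k (pd j (pd j u)) x := by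
    intro j
    have e : pd j (pd k u) = pd k (pd j u) := by funext y; exact pd_comm hu j k y
    rw [e, pd_comm (pd_smooth hu j)]
  have e2 : lap u = fun y => pd 0 (pd 0 u) y + pd 1 (pd 1 u) y := rfl
  rw [lap, h, h, e2, pd_add (smooth_diff (pd_smooth (pd_smooth hu 0) 0))
    (smooth_diff (pd_smooth (pd_smooth hu 1) 1))]

lemma lap_add {f g : E2 → ℝ} (hf : ContDiff ℝ (⊤ : ℕ∞) f) (hg : ContDiff ℝ (⊤ : ℕ∞) g) (x : E2) :
    lap (fun y => f y + g y) x = lap f x + lap g x := by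
  have e : ∀ k, pd k (fun y => f y + g y) = fun y => pd k f y + pd k g y := by
    intro k; funext y; exact pd_add (smooth_diff hf) (smooth_diff hg) k y
  rw [lap, e, e, pd_add (smooth_diff (pd_smooth hf _)) (smooth_diff (pd_smooth hg _)),
    pd_add (smooth_diff (pd_smooth hf _)) (smooth_diff (pd_smooth hg _)), lap, lap]
  ring

lemma bochner {A : Set E2} (hA : IsOpen A) {ε : ℝ} (hu : ContDiff ℝ (⊤ : ℕ∞) u)
    (hpde : ∀ x ∈ A, -lap u x = ((1 / ε ^ 2) * (1 - ‖u x‖ ^ 2)) • u x) {x : E2} (hx : x ∈ A) :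
    2 * hessSq u x - 2 * (1 / ε ^ 2) * Wf u x * gradSqNorm u x ≤ lap (gradSqNorm u) x := by
  have e : gradSqNorm u = fun y => ‖pd 0 u y‖ ^ 2 + ‖pd 1 u y‖ ^ 2 := by
    funext y; simp [gradSqNorm]
  have hk : ∀ k, lap (fun y => ‖pd k u y‖ ^ 2) x = 2 * gradSqNorm (pd k u) x
      + (1 / ε ^ 2) * pd k (Wf u) x ^ 2 - 2 * (1 / ε ^ 2) * Wf u x * ‖pd k u x‖ ^ 2 := by
    intro k
    rw [lap_normsq (pd_smooth hu k), lap_pd hu]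
    have e3 : pd k (lap u) x = pd k (fun y => (-(1 / ε ^ 2) * Wf u y) • u y) x := by
      refine pd_eqOn hA (fun y hy => ?_) k hx
      rw [neg_mul, neg_smul, Wf, ← hpde y hy, neg_neg]
    have hW : ContDiff ℝ (⊤ : ℕ∞) (fun y => -(1 / ε ^ 2) * Wf u y) :=
      contDiff_const.mul (Wf_smooth hu)
    rw [e3, pd_smul (smooth_diff hW) (smooth_diff hu),
      pd_mul (f := fun _ => -(1 / ε ^ 2)) (by fun_prop) (smooth_diff (Wf_smooth hu)), pd_const,
      inner_add_right, inner_smul_right, inner_smul_right, real_inner_self_eq_norm_sq,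
      real_inner_comm, zero_mul, add_zero]
    have := pd_Wf hu k x
    rw [pow_two (pd k (Wf u) x)]
    nth_rewrite 3 [this]
    ring
  rw [e, lap_add ((pd_smooth hu 0).norm_sq ℝ) ((pd_smooth hu 1).norm_sq ℝ), hk, hk]
  simp only [hessSq, Fin.sum_univ_two]
  have : 0 ≤ (1 / ε ^ 2) * pd 0 (Wf u) x ^ 2 := by positivity
  have : 0 ≤ (1 / ε ^ 2) * pd 1 (Wf u) x ^ 2 := by positivity
  linarith

lemma green {A : Set E2} (hA : Bornology.IsBounded A) {z g : E2 → ℝ}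
    (hz : ContDiff ℝ (⊤ : ℕ∞) z) (hg : ContDiff ℝ (⊤ : ℕ∞) g) (hs : tsupport z ⊆ A) :
    ∫ x in A, z x * lap g x = ∫ x in A, g x * lap z x := by
  have hk : ∀ k, ∫ x in A, (z x * pd k (pd k g) x - g x * pd k (pd k z) x) = 0 := by
    intro k
    have hsm : ContDiff ℝ (⊤ : ℕ∞) (fun x => z x * pd k g x - g x * pd k z x) :=
      (hz.mul (pd_smooth hg k)).sub (hg.mul (pd_smooth hz k))
    have h := integral_pd hA hsm ?_ k
    · rw [← h]
      congr 1
      funext x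
      rw [pd_sub (smooth_diff (hz.mul (pd_smooth hg k))) (smooth_diff (hg.mul (pd_smooth hz k))),
        pd_mul (smooth_diff hz) (smooth_diff (pd_smooth hg k)),
        pd_mul (smooth_diff hg) (smooth_diff (pd_smooth hz k))]
      ring
    · refine subset_trans (closure_minimal ?_ (isClosed_tsupport z)) hs
      intro x hx
      by_contra hn
      apply hx
      simp [zero_of_notMem subset_rfl hn, pd_zero_of_notMem subset_rfl k hn]
  have c1 := fun k => (pd_smooth (pd_smooth hz k) k).continuous
  have c2 := fun k => (pd_smooth (pd_smooth hg k) k).continuous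
  have c3 := hz.continuous
  have c4 := hg.continuous
  have h0 := hk 0
  have h1 := hk 1
  have i : ∀ k, Integrable (fun x => z x * pd k (pd k g) x - g x * pd k (pd k z) x)
    (volume.restrict A) := fun k => int_of_cont hA (by fun_prop)
  rw [← sub_eq_zero, ← integral_sub]
  · have h2 := integral_add (i 0) (i 1)
    rw [h0, h1, add_zero] at h2
    rw [← h2]
    congr 1
    funext x
    simp only [lap]; ring
  · exact int_of_cont hA (c3.mul (lap_smooth hg).continuous)
  · exact int_of_cont hA (c4.mul (lap_smooth hz).continuous)

lemma hess_ineq {A : Set E2} (hA : Bornology.IsBounded A) (hAo : IsOpen A) {ε : ℝ}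
    (hu : ContDiff ℝ (⊤ : ℕ∞) u)
    (hpde : ∀ x ∈ A, -lap u x = ((1 / ε ^ 2) * (1 - ‖u x‖ ^ 2)) • u x)
    {η : E2 → ℝ} (hη : ContDiff ℝ (⊤ : ℕ∞) η) (hs : tsupport η ⊆ A) :
    2 * ∫ x in A, η x ^ 2 * hessSq u x ≤ (∫ x in A, gradSqNorm u x * lap (fun y => η y ^ 2) x)
      + 2 * (1 / ε ^ 2) * ∫ x in A, η x ^ 2 * (Wf u x * gradSqNorm u x) := by
  have hz : ContDiff ℝ (⊤ : ℕ∞) (fun y => η y ^ 2) := hη.pow 2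
  have hzs : tsupport (fun y => η y ^ 2) ⊆ A := by
    refine subset_trans (closure_minimal ?_ (isClosed_tsupport η)) hs
    intro x hx
    by_contra hn
    apply hx
    simp [zero_of_notMem subset_rfl hn]
  rw [← green hA hz (gradSq_smooth hu) hzs, ← integral_const_mul, ← integral_const_mul,
    ← integral_add]
  · have c1 := (lap_smooth (gradSq_smooth hu)).continuous
    have c2 := (gradSq_smooth hu).continuous
    have c3 := (hessSq_smooth hu).continuous
    have c4 := (Wf_smooth hu).continuous
    have c5 := hη.continuous
    refine setIntegral_mono_on (int_of_cont hA (by fun_prop)) (int_of_cont hA (by fun_prop))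
      hAo.measurableSet ?_
    intro x hx
    have := mul_le_mul_of_nonneg_left (bochner hAo hu hpde hx) (sq_nonneg (η x))
    linarith
  · exact int_of_cont hA (hz.continuous.mul (lap_smooth (gradSq_smooth hu)).continuous)
  · have c2 := (gradSq_smooth hu).continuous
    have c4 := (Wf_smooth hu).continuous
    have c5 := hη.continuous
    exact int_of_cont hA (by fun_prop)

end smooth

lemma green1 {A : Set E2} (hA : Bornology.IsBounded A) {z g : E2 → ℝ}
    (hz : ContDiff ℝ (⊤ : ℕ∞) z) (hg : ContDiff ℝ (⊤ : ℕ∞) g) (hs : tsupport z ⊆ A) :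
    ∫ x in A, (z x * lap g x + (pd 0 z x * pd 0 g x + pd 1 z x * pd 1 g x)) = 0 := by
  have hk : ∀ k, ∫ x in A, (z x * pd k (pd k g) x + pd k z x * pd k g x) = 0 := by
    intro k
    have h := integral_pd hA (hz.mul (pd_smooth hg k)) ?_ k
    · rw [← h]
      congr 1
      funext x
      rw [pd_mul (smooth_diff hz) (smooth_diff (pd_smooth hg k))]
    · refine subset_trans (closure_minimal ?_ (isClosed_tsupport z)) hs
      intro x hx
      by_contra hn
      apply hx
      simp [zero_of_notMem subset_rfl hn]
  have c1 := fun k => (pd_smooth hz k).continuous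
  have c2 := fun k => (pd_smooth (pd_smooth hg k) k).continuous
  have c3 := hz.continuous
  have c4 := fun k => (pd_smooth hg k).continuous
  have i : ∀ k, Integrable (fun x => z x * pd k (pd k g) x + pd k z x * pd k g x)
    (volume.restrict A) := fun k => int_of_cont hA (by fun_prop)
  have h2 := integral_add (i 0) (i 1)
  rw [hk 0, hk 1, add_zero] at h2
  rw [← h2]
  congr 1
  funext x
  simp only [lap]; ring

lemma w_ineq {F : Type} [NormedAddCommGroup F] [InnerProductSpace ℝ F] {u : E2 → F}
    {Cg : ℝ} (hCg : 0 < Cg)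
    (hgns : ∀ (A : Set E2), Bornology.IsBounded A → ∀ g : E2 → ℝ,
      ContDiff ℝ (⊤ : ℕ∞) g → tsupport g ⊆ A →
      ∫ x in A, g x ^ 2 ≤ Cg * (∫ x in A, (|pd 0 g x| + |pd 1 g x|)) ^ 2)
    {A : Set E2} (hA : Bornology.IsBounded A) (hAo : IsOpen A) {ε : ℝ} (hε : 0 < ε)
    (hu : ContDiff ℝ (⊤ : ℕ∞) u)
    (hpde : ∀ x ∈ A, -lap u x = ((1 / ε ^ 2) * (1 - ‖u x‖ ^ 2)) • u x)
    (hsmall : 32 * Cg * ∫ x in A, Wf u x ^ 2 ≤ ε ^ 2)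
    {φ : E2 → ℝ} (hφ : ContDiff ℝ (⊤ : ℕ∞) φ) (hs : tsupport φ ⊆ A) :
    ∫ x in A, φ x ^ 2 * Wf u x ^ 2 ≤ ε ^ 2 * (2 * (∫ x in A, φ x ^ 2 * (Wf u x * gradSqNorm u x))
      + 3 * ∫ x in A, gradSqNorm φ x * Wf u x ^ 2) := by
  have hW := Wf_smooth hu
  have cW := hW.continuous
  have cu := hu.continuous
  have cφ := hφ.continuous
  have cg := (gradSq_smooth hu).continuous
  have cgφ := (gradSq_smooth hφ).continuous
  have cgW := (gradSq_smooth hW).continuous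
  have cpφ := fun k => (pd_smooth hφ k).continuous
  have cpW := fun k => (pd_smooth hW k).continuous
  have clW := (lap_smooth hW).continuous
  -- first identity
  have hz : ContDiff ℝ (⊤ : ℕ∞) (fun x => φ x ^ 2 * Wf u x) := (hφ.pow 2).mul hW
  have hzs : tsupport (fun x => φ x ^ 2 * Wf u x) ⊆ A := by
    refine subset_trans (closure_minimal ?_ (isClosed_tsupport φ)) hs
    intro x hx
    by_contra hn
    apply hx
    simp [zero_of_notMem subset_rfl hn]
  have hpz : ∀ k x, pd k (fun x => φ x ^ 2 * Wf u x) x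
      = φ x ^ 2 * pd k (Wf u) x + 2 * φ x * pd k φ x * Wf u x := by
    intro k x
    rw [pd_mul (f := fun x => φ x ^ 2) (smooth_diff (hφ.pow 2)) (smooth_diff hW)]
    have : (fun x => φ x ^ 2) = fun x => φ x * φ x := by funext y; ring
    rw [this, pd_mul (smooth_diff hφ) (smooth_diff hφ)]
    ring
  have h1 := green1 hA hz hW hzs
  have h2 : ∫ x in A, ((1/2) * (φ x ^ 2 * gradSqNorm (Wf u) x)
      + (2 * (1 / ε ^ 2)) * (φ x ^ 2 * (‖u x‖ ^ 2 * Wf u x ^ 2))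
      - 2 * (φ x ^ 2 * (Wf u x * gradSqNorm u x)) - 2 * (gradSqNorm φ x * Wf u x ^ 2)) ≤ 0 := by
    rw [← h1]
    refine setIntegral_mono_on (int_of_cont hA (by fun_prop)) (int_of_cont hA ?_)
      hAo.measurableSet ?_
    · have := fun k => (pd_smooth hz k).continuous
      fun_prop
    intro x hx
    rw [lap_Wf hu hpde hx, hpz, hpz, gradSq_real (Wf u), gradSq_real φ]
    nlinarith [sq_nonneg (φ x * pd 0 (Wf u) x + 2 * pd 0 φ x * Wf u x),
      sq_nonneg (φ x * pd 1 (Wf u) x + 2 * pd 1 φ x * Wf u x)]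
  rw [integral_sub, integral_sub, integral_add, integral_const_mul, integral_const_mul,
    integral_const_mul, integral_const_mul] at h2
  rotate_left
  iterate 6 exact int_of_cont hA (by fun_prop)
  -- pointwise
  have h3 : ∫ x in A, φ x ^ 2 * Wf u x ^ 2 ≤ ∫ x in A, (2 * (φ x ^ 2 * (‖u x‖ ^ 2 * Wf u x ^ 2))
      + (φ x * Wf u x ^ 2) ^ 2) := by
    refine integral_mono (int_of_cont hA (by fun_prop)) (int_of_cont hA (by fun_prop)) ?_
    intro x
    have e : ‖u x‖ ^ 2 = 1 - Wf u x := by simp [Wf]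
    dsimp only
    rw [e]
    nlinarith [sq_nonneg (φ x * Wf u x * (Wf u x - 1))]
  rw [integral_add (int_of_cont hA (by fun_prop)) (int_of_cont hA (by fun_prop)),
    integral_const_mul] at h3
  -- GNS
  have hv : ContDiff ℝ (⊤ : ℕ∞) (fun x => φ x * Wf u x ^ 2) := hφ.mul (hW.pow 2)
  have hvs : tsupport (fun x => φ x * Wf u x ^ 2) ⊆ A := by
    refine subset_trans (closure_minimal ?_ (isClosed_tsupport φ)) hs
    intro x hx
    by_contra hn
    apply hx
    simp [zero_of_notMem subset_rfl hn]
  have hpv : ∀ k x, |pd k (fun x => φ x * Wf u x ^ 2) x|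
      ≤ |Wf u x| * (2 * |φ x| * |pd k (Wf u) x| + |pd k φ x| * |Wf u x|) := by
    intro k x
    have : (fun x => φ x * Wf u x ^ 2) = fun x => (φ x * Wf u x) * Wf u x := by funext y; ring
    rw [this, pd_mul (smooth_diff (hφ.mul hW)) (smooth_diff hW),
      pd_mul (smooth_diff hφ) (smooth_diff hW)]
    have : φ x * Wf u x * pd k (Wf u) x + (φ x * pd k (Wf u) x + pd k φ x * Wf u x) * Wf u x
      = Wf u x * (2 * φ x * pd k (Wf u) x + pd k φ x * Wf u x) := by ring
    rw [this, abs_mul]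
    gcongr
    refine (abs_add_le _ _).trans ?_
    simp [abs_mul]
  have h4 := hgns A hA _ hv hvs
  have h5 : ∫ x in A, (|pd 0 (fun x => φ x * Wf u x ^ 2) x| + |pd 1 (fun x => φ x * Wf u x ^ 2) x|)
      ≤ ∫ x in A, |Wf u x| * (2 * |φ x| * (|pd 0 (Wf u) x| + |pd 1 (Wf u) x|)
        + (|pd 0 φ x| + |pd 1 φ x|) * |Wf u x|) := by
    refine integral_mono (int_of_cont hA ?_) (int_of_cont hA (by fun_prop)) ?_
    · have := fun k => (pd_smooth hv k).continuous
      fun_prop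
    intro x
    have := hpv 0 x
    have := hpv 1 x
    dsimp only
    linarith
  have h5' : 0 ≤ ∫ x in A, (|pd 0 (fun x => φ x * Wf u x ^ 2) x|
      + |pd 1 (fun x => φ x * Wf u x ^ 2) x|) := integral_nonneg fun x => by positivity
  have h6 := cs_ineq hA (f := fun x => |Wf u x|) (g := fun x =>
    (2 * |φ x| * (|pd 0 (Wf u) x| + |pd 1 (Wf u) x|) + (|pd 0 φ x| + |pd 1 φ x|) * |Wf u x|))
    (by fun_prop) (by fun_prop)
  simp only [sq_abs] at h6
  have h7 : ∫ x in A, (2 * |φ x| * (|pd 0 (Wf u) x| + |pd 1 (Wf u) x|)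
        + (|pd 0 φ x| + |pd 1 φ x|) * |Wf u x|) ^ 2
      ≤ ∫ x in A, (16 * (φ x ^ 2 * gradSqNorm (Wf u) x) + 16 * (gradSqNorm φ x * Wf u x ^ 2)) := by
    refine integral_mono (int_of_cont hA (by fun_prop)) (int_of_cont hA (by fun_prop)) ?_
    intro x
    dsimp only
    rw [gradSq_real (Wf u), gradSq_real φ, ← sq_abs (φ x), ← sq_abs (Wf u x),
      ← sq_abs (pd 0 (Wf u) x), ← sq_abs (pd 1 (Wf u) x), ← sq_abs (pd 0 φ x),
      ← sq_abs (pd 1 φ x)]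
    generalize |φ x| = a
    generalize |Wf u x| = w
    generalize |pd 0 (Wf u) x| = w0
    generalize |pd 1 (Wf u) x| = w1
    generalize |pd 0 φ x| = p0
    generalize |pd 1 φ x| = p1
    nlinarith [sq_nonneg (2 * a * (w0 + w1) - (p0 + p1) * w), sq_nonneg (a * (w0 - w1)),
      sq_nonneg (w * (p0 - p1)), sq_nonneg (w * p0), sq_nonneg (w * p1)]
  rw [integral_add (int_of_cont hA (by fun_prop)) (int_of_cont hA (by fun_prop)),
    integral_const_mul, integral_const_mul] at h7
  have hP : 0 ≤ ∫ x in A, φ x ^ 2 * gradSqNorm (Wf u) x :=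
    integral_nonneg fun x => mul_nonneg (sq_nonneg _) (gradSq_nonneg _ _)
  have hT : 0 ≤ ∫ x in A, gradSqNorm φ x * Wf u x ^ 2 :=
    integral_nonneg fun x => mul_nonneg (gradSq_nonneg _ _) (sq_nonneg _)
  have hWW : 0 ≤ ∫ x in A, Wf u x ^ 2 := integral_nonneg fun x => sq_nonneg _
  set P := ∫ x in A, φ x ^ 2 * gradSqNorm (Wf u) x
  set T := ∫ x in A, gradSqNorm φ x * Wf u x ^ 2
  set Q := ∫ x in A, φ x ^ 2 * (‖u x‖ ^ 2 * Wf u x ^ 2)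
  set S := ∫ x in A, φ x ^ 2 * (Wf u x * gradSqNorm u x)
  set w := ∫ x in A, Wf u x ^ 2
  set X := ∫ x in A, φ x ^ 2 * Wf u x ^ 2
  have h8 : ∫ x in A, (φ x * Wf u x ^ 2) ^ 2 ≤ (ε ^ 2 / 2) * (P + T) := by
    calc _ ≤ _ := h4
      _ ≤ Cg * (w * (16 * P + 16 * T)) := by
          gcongr
          refine (pow_le_pow_left₀ h5' h5 2).trans (h6.trans ?_)
          gcongr
      _ = (32 * Cg * w) * ((P + T) / 2) := by ring
      _ ≤ ε ^ 2 * ((P + T) / 2) := by gcongr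
      _ = _ := by ring
  have hε2 : 0 < ε ^ 2 := by positivity
  have h9 : 2 * Q ≤ ε ^ 2 * (2 * S + 2 * T - P / 2) := by
    have := mul_le_mul_of_nonneg_left h2 hε2.le
    have e : ε ^ 2 * (1 / ε ^ 2) = 1 := by field_simp
    have e2 : ε ^ 2 * (1 / 2 * P + 2 * (1 / ε ^ 2) * Q - 2 * S - 2 * T)
      = ε ^ 2 * (1 / 2 * P - 2 * S - 2 * T) + 2 * (ε ^ 2 * (1 / ε ^ 2)) * Q := by ring
    rw [e2, e] at this
    linarith
  have := mul_nonneg hε2.le hT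
  linarith

lemma lady {F : Type} [NormedAddCommGroup F] [InnerProductSpace ℝ F] {u : E2 → F}
    {Cg : ℝ} (hCg : 0 < Cg)
    (hgns : ∀ (A : Set E2), Bornology.IsBounded A → ∀ g : E2 → ℝ,
      ContDiff ℝ (⊤ : ℕ∞) g → tsupport g ⊆ A →
      ∫ x in A, g x ^ 2 ≤ Cg * (∫ x in A, (|pd 0 g x| + |pd 1 g x|)) ^ 2)
    {A : Set E2} (hA : Bornology.IsBounded A)
    (hu : ContDiff ℝ (⊤ : ℕ∞) u)
    {η : E2 → ℝ} (hη : ContDiff ℝ (⊤ : ℕ∞) η) (hs : tsupport η ⊆ A)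
    {M : ℝ} (hM : ∀ k x, |pd k η x| ≤ M) :
    ∫ x in A, (η x * gradSqNorm u x) ^ 2 ≤ Cg * ((∫ x in A, gradSqNorm u x) *
      (32 * (∫ x in A, η x ^ 2 * hessSq u x) + 8 * M ^ 2 * ∫ x in A, gradSqNorm u x)) := by
  have cη := hη.continuous
  have cg := (gradSq_smooth hu).continuous
  have ch := (hessSq_smooth hu).continuous
  have hv : ContDiff ℝ (⊤ : ℕ∞) (fun x => η x * gradSqNorm u x) := hη.mul (gradSq_smooth hu)
  have hvs : tsupport (fun x => η x * gradSqNorm u x) ⊆ A := by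
    refine subset_trans (closure_minimal ?_ (isClosed_tsupport η)) hs
    intro x hx
    by_contra hn
    apply hx
    simp [zero_of_notMem subset_rfl hn]
  have hn1 : ∀ j x, ‖pd j u x‖ ≤ √(gradSqNorm u x) := by
    intro j x
    apply Real.le_sqrt_of_sq_le
    exact Finset.single_le_sum (f := fun k => ‖pd k u x‖ ^ 2) (fun k _ => sq_nonneg _)
      (Finset.mem_univ j)
  have hn2 : ∀ x, ‖pd 0 (pd 0 u) x‖ + ‖pd 0 (pd 1 u) x‖ + ‖pd 1 (pd 0 u) x‖ + ‖pd 1 (pd 1 u) x‖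
      ≤ 2 * √(hessSq u x) := by
    intro x
    have hh : hessSq u x = ‖pd 0 (pd 0 u) x‖ ^ 2 + ‖pd 1 (pd 0 u) x‖ ^ 2
        + (‖pd 0 (pd 1 u) x‖ ^ 2 + ‖pd 1 (pd 1 u) x‖ ^ 2) := by
      simp [hessSq, gradSqNorm]
    have e : 2 * √(hessSq u x) = √(4 * hessSq u x) := by
      rw [Real.sqrt_mul (by norm_num), show (4:ℝ) = 2 ^ 2 by norm_num, Real.sqrt_sq (by norm_num)]
    rw [e]
    apply Real.le_sqrt_of_sq_le
    rw [hh]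
    generalize ‖pd 0 (pd 0 u) x‖ = a
    generalize ‖pd 0 (pd 1 u) x‖ = b
    generalize ‖pd 1 (pd 0 u) x‖ = c
    generalize ‖pd 1 (pd 1 u) x‖ = d
    nlinarith [sq_nonneg (a - b), sq_nonneg (a - c), sq_nonneg (a - d), sq_nonneg (b - c),
      sq_nonneg (b - d), sq_nonneg (c - d)]
  have hpg : ∀ k x, |pd k (gradSqNorm u) x|
      ≤ 2 * (√(gradSqNorm u x) * (‖pd k (pd 0 u) x‖ + ‖pd k (pd 1 u) x‖)) := by
    intro k x
    have e : gradSqNorm u = fun y => ‖pd 0 u y‖ ^ 2 + ‖pd 1 u y‖ ^ 2 := by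
      funext y; simp [gradSqNorm]
    have e2 : pd k (gradSqNorm u) x = 2 * inner ℝ (pd 0 u x) (pd k (pd 0 u) x)
        + 2 * inner ℝ (pd 1 u x) (pd k (pd 1 u) x) := by
      rw [e, pd_add (smooth_diff ((pd_smooth hu 0).norm_sq ℝ))
        (smooth_diff ((pd_smooth hu 1).norm_sq ℝ)), pd_normsq (smooth_diff (pd_smooth hu 0)),
        pd_normsq (smooth_diff (pd_smooth hu 1))]
    have i : ∀ j, |inner ℝ (pd j u x) (pd k (pd j u) x)|
        ≤ √(gradSqNorm u x) * ‖pd k (pd j u) x‖ := fun j =>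
      (abs_real_inner_le_norm _ _).trans (by gcongr; exact hn1 j x)
    rw [e2]
    refine (abs_add_le _ _).trans ?_
    rw [abs_mul, abs_mul, abs_two]
    have := i 0
    have := i 1
    linarith
  have hpv : ∀ x, |pd 0 (fun x => η x * gradSqNorm u x) x|
      + |pd 1 (fun x => η x * gradSqNorm u x) x|
      ≤ √(gradSqNorm u x) * (4 * |η x| * √(hessSq u x) + 2 * M * √(gradSqNorm u x)) := by
    intro x
    have hk : ∀ k, |pd k (fun x => η x * gradSqNorm u x) x| ≤
        |η x| * (2 * (√(gradSqNorm u x) * (‖pd k (pd 0 u) x‖ + ‖pd k (pd 1 u) x‖)))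
          + M * gradSqNorm u x := by
      intro k
      rw [pd_mul (smooth_diff hη) (smooth_diff (gradSq_smooth hu))]
      refine (abs_add_le _ _).trans ?_
      rw [abs_mul, abs_mul, abs_of_nonneg (gradSq_nonneg u x)]
      have := gradSq_nonneg u x
      gcongr
      · exact hpg k x
      · exact hM k x
    have h0 := hk 0
    have h1 := hk 1
    have hsq := Real.mul_self_sqrt (gradSq_nonneg u x)
    have := mul_le_mul_of_nonneg_left (hn2 x) (mul_nonneg (abs_nonneg (η x))
      (Real.sqrt_nonneg (gradSqNorm u x)))
    have e : √(gradSqNorm u x) * (4 * |η x| * √(hessSq u x) + 2 * M * √(gradSqNorm u x))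
      = 2 * (|η x| * √(gradSqNorm u x) * (2 * √(hessSq u x)))
        + 2 * M * (√(gradSqNorm u x) * √(gradSqNorm u x)) := by ring
    rw [e, hsq]
    linarith
  have h4 := hgns A hA _ hv hvs
  have h5 : ∫ x in A, (|pd 0 (fun x => η x * gradSqNorm u x) x|
        + |pd 1 (fun x => η x * gradSqNorm u x) x|)
      ≤ ∫ x in A, √(gradSqNorm u x) * (4 * |η x| * √(hessSq u x) + 2 * M * √(gradSqNorm u x)) := by
    refine integral_mono (int_of_cont hA ?_) (int_of_cont hA (by fun_prop)) hpv
    have := fun k => (pd_smooth hv k).continuous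
    fun_prop
  have h5' : 0 ≤ ∫ x in A, (|pd 0 (fun x => η x * gradSqNorm u x) x|
      + |pd 1 (fun x => η x * gradSqNorm u x) x|) := integral_nonneg fun x => by positivity
  have h6 := cs_ineq hA (f := fun x => √(gradSqNorm u x)) (g := fun x =>
    (4 * |η x| * √(hessSq u x) + 2 * M * √(gradSqNorm u x))) (by fun_prop) (by fun_prop)
  simp only [Real.sq_sqrt (gradSq_nonneg u _)] at h6
  have h7 : ∫ x in A, (4 * |η x| * √(hessSq u x) + 2 * M * √(gradSqNorm u x)) ^ 2
      ≤ ∫ x in A, (32 * (η x ^ 2 * hessSq u x) + 8 * M ^ 2 * gradSqNorm u x) := by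
    refine integral_mono (int_of_cont hA (by fun_prop)) (int_of_cont hA (by fun_prop)) ?_
    intro x
    dsimp only
    have e1 := Real.sq_sqrt (gradSq_nonneg u x)
    have e2 := Real.sq_sqrt (hessSq_nonneg u x)
    rw [← sq_abs (η x)]
    nth_rewrite 2 [← e1]
    nth_rewrite 2 [← e2]
    nlinarith [sq_nonneg (4 * |η x| * √(hessSq u x) - 2 * M * √(gradSqNorm u x))]
  rw [integral_add (int_of_cont hA (by fun_prop)) (int_of_cont hA (by fun_prop)),
    integral_const_mul, integral_const_mul] at h7
  refine h4.trans ?_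
  have hgp : 0 ≤ ∫ x in A, gradSqNorm u x := integral_nonneg fun x => gradSq_nonneg _ _
  gcongr
  refine (pow_le_pow_left₀ h5' h5 2).trans (h6.trans ?_)
  gcongr

set_option maxHeartbeats 4000000 in
lemma core (m : ℕ) {A K : Set E2} (hA : Bornology.IsBounded A) (hAo : IsOpen A)
    (hK : IsCompact K) (hKA : K ⊆ A) :
    ∃ δ₀ > (0 : ℝ), ∃ C > (0 : ℝ), ∃ c > (0 : ℝ), ∀ (ε : ℝ), 0 < ε →
      ∀ (u : E2 → EuclideanSpace ℝ (Fin m)), ContDiff ℝ (⊤ : ℕ∞) u →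
      (∀ x ∈ A, -lap u x = ((1 / ε ^ 2) * (1 - ‖u x‖ ^ 2)) • u x) →
      (∀ x ∈ A, ‖u x‖ ≤ 1) → (∫ x in A, eDens ε u x) < δ₀ →
      ∫ x in K, Wf u x ^ 2 ≤
        ε ^ 4 * (C * ((∫ x in A, eDens ε u x) + (1 / ε ^ 2) * Real.exp (-(c / ε))) ^ 2) := by
  obtain ⟨Cg, hCg, hgns⟩ := gns
  obtain ⟨χ, hχ, hχc, hχA, hχ1, hχI⟩ := exists_cutoff hK hAo hKA
  obtain ⟨η, hη, hηc, hηA, hη1, hηI⟩ := exists_cutoff hχc hAo hχA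
  have hcs : ∀ {f : E2 → ℝ}, HasCompactSupport f → ∀ k, HasCompactSupport (pd k f) :=
    fun {f} hf k => hf.of_isClosed_subset (isClosed_tsupport _) (tsupport_pd f k)
  have hη2c : HasCompactSupport (fun y => η y ^ 2) :=
    hηc.of_isClosed_subset (isClosed_tsupport _) (closure_mono (fun x hx h0 => hx (by simp [h0])))
  obtain ⟨M1, hM1, hb1⟩ := cs_bound (pd_smooth hη 0).continuous (hcs hηc 0)
  obtain ⟨M2, hM2, hb2⟩ := cs_bound (pd_smooth hη 1).continuous (hcs hηc 1)
  obtain ⟨M3, hM3, hb3⟩ := cs_bound (pd_smooth hχ 0).continuous (hcs hχc 0)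
  obtain ⟨M4, hM4, hb4⟩ := cs_bound (pd_smooth hχ 1).continuous (hcs hχc 1)
  obtain ⟨M5, hM5, hb5⟩ := cs_bound (lap_smooth (hη.pow 2)).continuous
    ((hcs (hcs hη2c 0) 0).add (hcs (hcs hη2c 1) 1))
  obtain ⟨M, hMdef⟩ : ∃ M, M = M1 + M2 + M3 + M4 + M5 := ⟨_, rfl⟩
  have hM : 0 < M := by rw [hMdef]; positivity
  have hbη : ∀ k x, |pd k η x| ≤ M := by
    intro k x
    have := hb1 x
    have := hb2 x
    fin_cases k <;> simp only [Fin.zero_eta, Fin.mk_one] <;> linarith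
  have hbχ : ∀ k x, |pd k χ x| ≤ M := by
    intro k x
    have := hb3 x
    have := hb4 x
    fin_cases k <;> simp only [Fin.zero_eta, Fin.mk_one] <;> linarith
  have hbl : ∀ x, |lap (fun y => η y ^ 2) x| ≤ M := fun x => (hb5 x).trans (by linarith)
  have hgη : ∀ x, gradSqNorm η x ≤ 2 * M ^ 2 := by
    intro x
    rw [gradSq_real, ← sq_abs, ← sq_abs (pd 1 η x)]
    have := pow_le_pow_left₀ (abs_nonneg _) (hbη 0 x) 2
    have := pow_le_pow_left₀ (abs_nonneg _) (hbη 1 x) 2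
    linarith
  have hgχ : ∀ x, gradSqNorm χ x ≤ 2 * M ^ 2 := by
    intro x
    rw [gradSq_real, ← sq_abs, ← sq_abs (pd 1 χ x)]
    have := pow_le_pow_left₀ (abs_nonneg _) (hbχ 0 x) 2
    have := pow_le_pow_left₀ (abs_nonneg _) (hbχ 1 x) 2
    linarith
  have hdis : ∀ x, χ x ≠ 0 → ∀ k, pd k η x = 0 := by
    intro x hx k
    have ho : IsOpen (Function.support χ) := hχ.continuous.isOpen_support
    rw [pd_eqOn ho (g := fun _ => (1:ℝ)) (fun y hy => hη1 y (subset_tsupport _ hy)) k hx, pd_const]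
  have hAfin : volume A < ⊤ := hA.measure_lt_top
  obtain ⟨a, ha⟩ : ∃ a, a = (volume A).toReal := ⟨_, rfl⟩
  have ha0 : 0 ≤ a := by rw [ha]; positivity
  obtain ⟨κ, hκ⟩ : ∃ κ, κ = 1 / (8 * M) := ⟨_, rfl⟩
  have hκ0 : 0 < κ := by rw [hκ]; positivity
  obtain ⟨CZ, hCZ⟩ : ∃ CZ, CZ = Cg * (128 * M + 1600 * M ^ 2) := ⟨_, rfl⟩
  have hCZ0 : 0 < CZ := by rw [hCZ]; positivity
  refine ⟨1 / (256 * Cg), by positivity, 8 * CZ + 48 * M ^ 2 * a + a * Real.exp (2 * κ),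
    by positivity, κ, hκ0, ?_⟩
  intro ε hε u hu hpde hu1 hE
  have hW := Wf_smooth hu
  have cW := hW.continuous
  have cη := hη.continuous
  have cg := (gradSq_smooth hu).continuous
  have cgη := (gradSq_smooth hη).continuous
  have hε2 : 0 < ε ^ 2 := by positivity
  have hWA : ∀ x ∈ A, Wf u x ^ 2 ≤ 1 := by
    intro x hx
    have h1 := hu1 x hx
    have h0 := norm_nonneg (u x)
    have : 0 ≤ Wf u x ∧ Wf u x ≤ 1 := by
      unfold Wf; constructor <;> nlinarith
    nlinarith [this.1, this.2]
  have hEeq : ∫ x in A, eDens ε u x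
      = (∫ x in A, gradSqNorm u x) / 2 + (∫ x in A, Wf u x ^ 2) / (4 * ε ^ 2) := by
    rw [← integral_div, ← integral_div, ← integral_add]
    · rfl
    · exact int_of_cont hA (by fun_prop)
    · exact int_of_cont hA (by fun_prop)
  have hg0 : 0 ≤ ∫ x in A, gradSqNorm u x := integral_nonneg fun x => gradSq_nonneg _ _
  have hw0 : 0 ≤ ∫ x in A, Wf u x ^ 2 := integral_nonneg fun x => sq_nonneg _
  have hwa : ∫ x in A, Wf u x ^ 2 ≤ a := by
    have : ∫ x in A, Wf u x ^ 2 ≤ ∫ x in A, (1:ℝ) :=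
      setIntegral_mono_on (int_of_cont hA (by fun_prop)) (int_of_cont hA (by fun_prop))
        hAo.measurableSet hWA
    simpa [ha, Measure.real] using this
  have hKw : ∫ x in K, Wf u x ^ 2 ≤ a := by
    refine le_trans ?_ hwa
    exact setIntegral_mono_set (int_of_cont hA (by fun_prop))
      (Filter.Eventually.of_forall fun x => sq_nonneg _) hKA.eventuallyLE
  generalize hEE : ∫ x in A, eDens ε u x = E at *
  have hE0 : 0 ≤ E := by rw [hEeq]; positivity
  have hgE : ∫ x in A, gradSqNorm u x ≤ 2 * E := by
    have : 0 ≤ (∫ x in A, Wf u x ^ 2) / (4 * ε ^ 2) := by positivity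
    linarith
  have hwE : ∫ x in A, Wf u x ^ 2 ≤ 4 * ε ^ 2 * E := by
    have : (∫ x in A, Wf u x ^ 2) / (4 * ε ^ 2) ≤ E := by linarith
    rw [div_le_iff₀ (by positivity)] at this
    linarith
  rcases le_total 1 ε with h1ε | hε1
  · -- large ε
    refine hKw.trans ?_
    have hexp : Real.exp (-(κ / ε)) ≥ Real.exp (-κ) := by
      apply Real.exp_le_exp.2
      have : κ / ε ≤ κ := div_le_self hκ0.le h1ε
      linarith
    have h1 : (1 / ε ^ 2 * Real.exp (-κ)) ^ 2 ≤ (E + 1 / ε ^ 2 * Real.exp (-(κ / ε))) ^ 2 := by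
      apply pow_le_pow_left₀ (by positivity)
      have : 1 / ε ^ 2 * Real.exp (-κ) ≤ 1 / ε ^ 2 * Real.exp (-(κ / ε)) := by gcongr
      linarith
    have h2 : Real.exp (2 * κ) * Real.exp (-κ) ^ 2 = 1 := by
      rw [← Real.exp_nat_mul, ← Real.exp_add]; simp
    calc a = ε ^ 4 * ((a * Real.exp (2 * κ)) * (1 / ε ^ 2 * Real.exp (-κ)) ^ 2) := by
          have : ε ^ 4 * ((a * Real.exp (2 * κ)) * (1 / ε ^ 2 * Real.exp (-κ)) ^ 2)
            = a * (ε ^ 4 * (1 / ε ^ 2) ^ 2) * (Real.exp (2 * κ) * Real.exp (-κ) ^ 2) := by ring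
          rw [this, h2]
          field_simp
      _ ≤ _ := by
          gcongr
          have : 0 ≤ 8 * CZ + 48 * M ^ 2 * a := by positivity
          linarith
  -- small ε
  have hCgE : 256 * Cg * E ≤ 1 := by
    rw [lt_div_iff₀ (by positivity)] at hE
    linarith
  have hsmall : 32 * Cg * ∫ x in A, Wf u x ^ 2 ≤ ε ^ 2 := by
    calc 32 * Cg * ∫ x in A, Wf u x ^ 2 ≤ 32 * Cg * (4 * ε ^ 2 * E) := by gcongr
      _ = (256 * Cg * E) * (ε ^ 2 / 2) := by ring
      _ ≤ 1 * (ε ^ 2 / 2) := by gcongr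
      _ ≤ ε ^ 2 := by linarith
  have hX := w_ineq hCg hgns hA hAo hε hu hpde hsmall hη hηA
  have hH := hess_ineq hA hAo hu hpde hη hηA
  have hZ := lady hCg hgns hA hu hη hηA hbη
  have hT : ∫ x in A, gradSqNorm η x * Wf u x ^ 2 ≤ 2 * M ^ 2 * ∫ x in A, Wf u x ^ 2 := by
    rw [← integral_const_mul]
    refine integral_mono (int_of_cont hA (by fun_prop)) (int_of_cont hA (by fun_prop)) ?_
    intro x
    exact mul_le_mul_of_nonneg_right (hgη x) (sq_nonneg _)
  have hL : ∫ x in A, gradSqNorm u x * lap (fun y => η y ^ 2) x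
      ≤ M * ∫ x in A, gradSqNorm u x := by
    rw [← integral_const_mul]
    have := (lap_smooth (hη.pow 2)).continuous
    refine integral_mono (int_of_cont hA (by fun_prop)) (int_of_cont hA (by fun_prop)) ?_
    intro x
    have := mul_le_mul_of_nonneg_left ((le_abs_self _).trans (hbl x)) (gradSq_nonneg u x)
    dsimp only
    linarith
  have hS : ∀ φ : E2 → ℝ, Continuous φ → (∀ x, φ x ^ 2 ≤ η x ^ 2) →
      2 * ε ^ 2 * ∫ x in A, φ x ^ 2 * (Wf u x * gradSqNorm u x)
      ≤ (1/2) * (∫ x in A, φ x ^ 2 * Wf u x ^ 2)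
        + 2 * ε ^ 4 * ∫ x in A, (η x * gradSqNorm u x) ^ 2 := by
    intro φ cφ hφη
    rw [← integral_const_mul, ← integral_const_mul, ← integral_const_mul, ← integral_add]
    · refine integral_mono (int_of_cont hA (by fun_prop)) (int_of_cont hA (by fun_prop)) ?_
      intro x
      dsimp only
      have h1 := mul_le_mul_of_nonneg_right (hφη x) (sq_nonneg (ε ^ 2 * gradSqNorm u x))
      nlinarith [sq_nonneg (φ x * (Wf u x - 2 * ε ^ 2 * gradSqNorm u x))]
    · exact int_of_cont hA (by fun_prop)
    · exact int_of_cont hA (by fun_prop)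
  have hSη := hS η cη (fun x => le_rfl)
  have hH0 : 0 ≤ ∫ x in A, η x ^ 2 * hessSq u x :=
    integral_nonneg fun x => mul_nonneg (sq_nonneg _) (hessSq_nonneg _ _)
  have hZ0 : 0 ≤ ∫ x in A, (η x * gradSqNorm u x) ^ 2 := integral_nonneg fun x => sq_nonneg _
  generalize (∫ x in A, (η x * gradSqNorm u x) ^ 2) = Z at *
  have hZbound : Z ≤ CZ * E ^ 2 := by
    generalize (∫ x in A, η x ^ 2 * hessSq u x) = H at *
    generalize (∫ x in A, η x ^ 2 * Wf u x ^ 2) = X at *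
    generalize (∫ x in A, η x ^ 2 * (Wf u x * gradSqNorm u x)) = S at *
    generalize (∫ x in A, gradSqNorm η x * Wf u x ^ 2) = T at *
    generalize (∫ x in A, gradSqNorm u x * lap (fun y => η y ^ 2) x) = L at *
    have hT2 : T ≤ 8 * M ^ 2 * ε ^ 2 * E := by
      refine hT.trans ?_
      calc 2 * M ^ 2 * ∫ x in A, Wf u x ^ 2 ≤ 2 * M ^ 2 * (4 * ε ^ 2 * E) := by gcongr
        _ = _ := by ring
    have hL2 : L ≤ M * (2 * E) := hL.trans (by gcongr)
    have hX2 : X ≤ ε ^ 4 * (4 * Z + 48 * M ^ 2 * E) := by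
      have := mul_le_mul_of_nonneg_left hT2 hε2.le
      nlinarith
    have hS2 : 2 * (1 / ε ^ 2) * S ≤ 4 * Z + 24 * M ^ 2 * E := by
      have h1 : 2 * ε ^ 2 * S ≤ ε ^ 4 * (4 * Z + 24 * M ^ 2 * E) := by linarith
      have e : 2 * (1 / ε ^ 2) * S = (2 * ε ^ 2 * S) / ε ^ 4 := by field_simp
      rw [e, div_le_iff₀ (by positivity)]
      linarith
    have hH2 : H ≤ (M + 12 * M ^ 2) * E + 2 * Z := by linarith
    have hZ2 : Z ≤ Cg * ((2 * E) * (32 * ((M + 12 * M ^ 2) * E + 2 * Z)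
        + 8 * M ^ 2 * (2 * E))) := by
      refine hZ.trans ?_
      gcongr
    have := mul_le_mul_of_nonneg_right hCgE hZ0
    rw [hCZ]
    nlinarith
  -- weighted cutoff
  have hφs : ContDiff ℝ (⊤ : ℕ∞) (fun x => η x * Real.exp (-(κ / ε) * (1 - χ x))) :=
    hη.mul ((contDiff_const.mul (contDiff_const.sub hχ)).exp)
  have hexps : ContDiff ℝ (⊤ : ℕ∞) (fun x => Real.exp (-(κ / ε) * (1 - χ x))) :=
    ((contDiff_const.mul (contDiff_const.sub hχ)).exp)
  have hpe : ∀ k x, pd k (fun x => Real.exp (-(κ / ε) * (1 - χ x))) x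
      = Real.exp (-(κ / ε) * (1 - χ x)) * ((κ / ε) * pd k χ x) := by
    intro k x
    have h1 : HasFDerivAt (fun x => -(κ / ε) * (1 - χ x)) (-(κ / ε) • (-fderiv ℝ χ x)) x :=
      ((smooth_diff hχ x).hasFDerivAt.const_sub 1).const_mul _
    have h2 := h1.exp
    unfold pd
    rw [h2.fderiv]
    simp
  have hpφ : ∀ k x, pd k (fun x => η x * Real.exp (-(κ / ε) * (1 - χ x))) x
      = Real.exp (-(κ / ε) * (1 - χ x)) * pd k η x
        + (κ / ε) * (η x * Real.exp (-(κ / ε) * (1 - χ x))) * pd k χ x := by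
    intro k x
    rw [pd_mul (smooth_diff hη) (smooth_diff hexps), hpe]
    ring
  obtain ⟨φ, hφd⟩ : ∃ φ : E2 → ℝ, φ = fun x => η x * Real.exp (-(κ / ε) * (1 - χ x)) := ⟨_, rfl⟩
  rw [← hφd] at hφs hpφ
  have hφA : tsupport φ ⊆ A := by
    refine subset_trans (closure_minimal ?_ (isClosed_tsupport η)) hηA
    intro x hx
    by_contra hn
    apply hx
    simp [hφd, zero_of_notMem subset_rfl hn]
  have cφ := hφs.continuous
  have hφη : ∀ x, φ x ^ 2 ≤ η x ^ 2 := by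
    intro x
    rw [hφd]
    have h0 := (hηI x).1
    apply pow_le_pow_left₀ (by positivity)
    refine mul_le_of_le_one_right h0 (Real.exp_le_one_iff.2 ?_)
    have : 0 ≤ (κ / ε) * (1 - χ x) := mul_nonneg (by positivity) (by linarith [(hχI x).2])
    linarith
  have hY := w_ineq hCg hgns hA hAo hε hu hpde hsmall hφs hφA
  have hSφ := hS φ cφ hφη
  have hgφ : ∀ x, gradSqNorm φ x ≤ 4 * M ^ 2 * Real.exp (-(κ / ε)) ^ 2
      + 4 * (κ / ε) ^ 2 * M ^ 2 * φ x ^ 2 := by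
    intro x
    have h1 : gradSqNorm φ x ≤ 2 * (Real.exp (-(κ / ε) * (1 - χ x)) ^ 2 * gradSqNorm η x)
        + 2 * ((κ / ε) ^ 2 * φ x ^ 2 * gradSqNorm χ x) := by
      rw [gradSq_real, gradSq_real, gradSq_real, hpφ, hpφ]
      have e : η x * Real.exp (-(κ / ε) * (1 - χ x)) = φ x := by rw [hφd]
      rw [e]
      generalize Real.exp (-(κ / ε) * (1 - χ x)) = b
      nlinarith [sq_nonneg (b * pd 0 η x - (κ / ε) * φ x * pd 0 χ x),
        sq_nonneg (b * pd 1 η x - (κ / ε) * φ x * pd 1 χ x)]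
    have h2 : Real.exp (-(κ / ε) * (1 - χ x)) ^ 2 * gradSqNorm η x
        ≤ Real.exp (-(κ / ε)) ^ 2 * (2 * M ^ 2) := by
      by_cases hx : χ x = 0
      · rw [hx, sub_zero, mul_one]
        gcongr
        exact hgη x
      · rw [gradSq_real, hdis x hx, hdis x hx]
        have : 0 ≤ Real.exp (-(κ / ε)) ^ 2 * (2 * M ^ 2) := by positivity
        simpa using this
    have h3 : (κ / ε) ^ 2 * φ x ^ 2 * gradSqNorm χ x ≤ (κ / ε) ^ 2 * φ x ^ 2 * (2 * M ^ 2) := by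
      gcongr
      exact hgχ x
    linarith
  have hTφ : ∫ x in A, gradSqNorm φ x * Wf u x ^ 2
      ≤ 4 * M ^ 2 * Real.exp (-(κ / ε)) ^ 2 * (∫ x in A, Wf u x ^ 2)
      + 4 * (κ / ε) ^ 2 * M ^ 2 * (∫ x in A, φ x ^ 2 * Wf u x ^ 2) := by
    rw [← integral_const_mul, ← integral_const_mul, ← integral_add]
    · have := (gradSq_smooth hφs).continuous
      refine integral_mono (int_of_cont hA (by fun_prop)) (int_of_cont hA (by fun_prop)) ?_
      intro x
      have := mul_le_mul_of_nonneg_right (hgφ x) (sq_nonneg (Wf u x))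
      dsimp only
      linarith
    · exact int_of_cont hA (by fun_prop)
    · exact int_of_cont hA (by fun_prop)
  have hKY : ∫ x in K, Wf u x ^ 2 ≤ ∫ x in A, φ x ^ 2 * Wf u x ^ 2 := by
    have h1 : ∫ x in K, Wf u x ^ 2 = ∫ x in K, φ x ^ 2 * Wf u x ^ 2 := by
      refine setIntegral_congr_fun hK.measurableSet ?_
      intro x hx
      have hχx := hχ1 x hx
      have hηx : η x = 1 := hη1 x (subset_tsupport _ (by simp [hχx]))
      simp [hφd, hχx, hηx]
    rw [h1]
    exact setIntegral_mono_set (int_of_cont hA (by fun_prop))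
      (Filter.Eventually.of_forall fun x => by positivity) hKA.eventuallyLE
  refine hKY.trans ?_
  have hY0 : 0 ≤ ∫ x in A, φ x ^ 2 * Wf u x ^ 2 := integral_nonneg fun x => by positivity
  generalize (∫ x in A, φ x ^ 2 * Wf u x ^ 2) = Y at *
  generalize (∫ x in A, φ x ^ 2 * (Wf u x * gradSqNorm u x)) = S at *
  generalize (∫ x in A, gradSqNorm φ x * Wf u x ^ 2) = T at *
  generalize (∫ x in A, Wf u x ^ 2) = w at *
  have hκM : ε ^ 2 * (4 * (κ / ε) ^ 2 * M ^ 2 * Y) = Y / 16 := by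
    rw [hκ]; field_simp; ring
  obtain ⟨b, hb⟩ : ∃ b, b = Real.exp (-(κ / ε)) := ⟨_, rfl⟩
  rw [← hb] at hTφ ⊢
  have hb0 : 0 < b := by rw [hb]; positivity
  have hT3 : ε ^ 2 * T ≤ ε ^ 2 * (4 * M ^ 2 * b ^ 2 * a) + Y / 16 := by
    rw [← hκM, ← mul_add]
    refine mul_le_mul_of_nonneg_left (hTφ.trans ?_) hε2.le
    gcongr
  have hY2 : Y ≤ 8 * ε ^ 4 * Z + 48 * M ^ 2 * a * (ε ^ 2 * b ^ 2) := by nlinarith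
  have hY3 : Y ≤ 8 * CZ * (ε ^ 4 * E ^ 2) + 48 * M ^ 2 * a * b ^ 2 := by
    have h1 : ε ^ 2 * b ^ 2 ≤ b ^ 2 := by
      refine mul_le_of_le_one_left (by positivity) ?_
      exact pow_le_one₀ hε.le hε1
    have h2 : 48 * M ^ 2 * a * (ε ^ 2 * b ^ 2) ≤ 48 * M ^ 2 * a * b ^ 2 := by gcongr
    have h3 : 8 * ε ^ 4 * Z ≤ 8 * ε ^ 4 * (CZ * E ^ 2) := by gcongr
    linarith
  have e : ε ^ 4 * ((8 * CZ + 48 * M ^ 2 * a + a * Real.exp (2 * κ)) * (E + 1 / ε ^ 2 * b) ^ 2)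
      = (8 * CZ + 48 * M ^ 2 * a + a * Real.exp (2 * κ)) * (ε ^ 2 * E + b) ^ 2 := by
    field_simp
  rw [e]
  have h5 : ε ^ 4 * E ^ 2 ≤ (ε ^ 2 * E + b) ^ 2 := by
    have : 0 ≤ ε ^ 2 * E * b := by positivity
    nlinarith [sq_nonneg b]
  have h6 : b ^ 2 ≤ (ε ^ 2 * E + b) ^ 2 := by
    have : 0 ≤ ε ^ 2 * E * b := by positivity
    nlinarith [sq_nonneg (ε ^ 2 * E)]
  have h7 : 8 * CZ * (ε ^ 4 * E ^ 2) ≤ 8 * CZ * (ε ^ 2 * E + b) ^ 2 := by gcongr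
  have h8 : 48 * M ^ 2 * a * b ^ 2 ≤ 48 * M ^ 2 * a * (ε ^ 2 * E + b) ^ 2 := by gcongr
  have h9 : 0 ≤ a * Real.exp (2 * κ) * (ε ^ 2 * E + b) ^ 2 := by positivity
  linarith

section scaling
variable {F : Type} [NormedAddCommGroup F] [NormedSpace ℝ F]

lemma pd_scale {f : E2 → F} (hf : Differentiable ℝ f) (R : ℝ) (k : Fin 2) (x : E2) :
    pd k (fun y => f (R • y)) x = R • pd k f (R • x) := by
  unfold pd
  have h1 : HasFDerivAt (fun y : E2 => R • y) (R • ContinuousLinearMap.id ℝ E2) x :=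
    (hasFDerivAt_id x).const_smul R
  have h2 := (hf (R • x)).hasFDerivAt.comp x h1
  have h3 : fderiv ℝ (fun y => f (R • y)) x
      = (fderiv ℝ f (R • x)).comp (R • ContinuousLinearMap.id ℝ E2) := h2.fderiv
  rw [h3]
  simp

lemma lap_scale {f : E2 → F} (hf : ContDiff ℝ (⊤ : ℕ∞) f) (R : ℝ) (x : E2) :
    lap (fun y => f (R • y)) x = R ^ 2 • lap f (R • x) := by
  have hd : Differentiable ℝ f := hf.differentiable (by simp)
  have key : ∀ k : Fin 2, pd k (pd k (fun y => f (R • y))) x = R ^ 2 • pd k (pd k f) (R • x) := by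
    intro k
    have h1 : pd k (fun y => f (R • y)) = fun y => (fun z => R • pd k f z) (R • y) := by
      funext y; exact pd_scale hd R k y
    have hp : ContDiff ℝ (⊤ : ℕ∞) (pd k f) := pd_smooth hf k
    have hpd : Differentiable ℝ (pd k f) := hp.differentiable (by simp)
    have hg : Differentiable ℝ (fun z => R • pd k f z) := hpd.const_smul R
    rw [h1, pd_scale hg R k x]
    have this : pd k (fun z => R • pd k f z) (R • x) = R • pd k (pd k f) (R • x) := by
      have h := pd_smul (f := fun _ : E2 => R) (differentiable_const R) hpd k (R • x)
      rw [pd_const, zero_smul, add_zero] at h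
      exact h
    rw [this, smul_smul, sq]
  unfold lap
  rw [key, key, smul_add]

lemma eDens_scale {f : E2 → F} (hf : Differentiable ℝ f) {R ε : ℝ} (hR : 0 < R) (hε : 0 < ε)
    (x : E2) :
    eDens (ε / R) (fun y => f (R • y)) x = R ^ 2 * eDens ε f (R • x) := by
  unfold eDens gradSqNorm
  simp only [pd_scale hf, norm_smul, Fin.sum_univ_two, Real.norm_eq_abs, abs_of_pos hR]
  field_simp

lemma int_scale (g : E2 → ℝ) {R : ℝ} (hR : 0 < R) (s t : Set E2) (hs : MeasurableSet s)
    (ht : MeasurableSet t)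
    (hst : ∀ x, R • x ∈ s ↔ x ∈ t) :
    ∫ x in s, g x = R ^ 2 * ∫ x in t, g (R • x) := by
  rw [← integral_indicator hs, ← integral_indicator ht]
  have h := Measure.integral_comp_smul (volume : Measure E2) (s.indicator g) R
  have h2 : (fun x => s.indicator g (R • x)) = t.indicator (fun x => g (R • x)) := by
    funext x
    by_cases hx : x ∈ t
    · rw [Set.indicator_of_mem hx, Set.indicator_of_mem ((hst x).2 hx)]
    · rw [Set.indicator_of_notMem hx, Set.indicator_of_notMem (fun h => hx ((hst x).1 h))]
  rw [h2] at h
  rw [h]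
  have h3 : Module.finrank ℝ E2 = 2 := by simp [E2]
  rw [h3, abs_of_pos (by positivity), smul_eq_mul]
  field_simp

lemma mem_ball_scale {R a : ℝ} (hR : 0 < R) (x : E2) :
    R • x ∈ ball (0 : E2) (R * a) ↔ x ∈ ball (0 : E2) a := by
  rw [mem_ball_zero_iff, mem_ball_zero_iff, norm_smul, Real.norm_eq_abs, abs_of_pos hR]
  exact mul_lt_mul_iff_right₀ hR

lemma mem_cball_scale {R a : ℝ} (hR : 0 < R) (x : E2) :
    R • x ∈ closedBall (0 : E2) (R * a) ↔ x ∈ closedBall (0 : E2) a := by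
  rw [mem_closedBall_zero_iff, mem_closedBall_zero_iff, norm_smul, Real.norm_eq_abs, abs_of_pos hR]
  exact mul_le_mul_iff_right₀ hR

end scaling

/-- control of the potential part of the energy on annuli
(Lemma 2.6 of the paper). -/
theorem ginzburg_landau_potential_control_on_annuli
    (n : ℕ) (hn : 1 ≤ n) :
    ∃ δ₀ > (0 : ℝ), ∃ C > (0 : ℝ), ∃ c > (0 : ℝ),
      ∀ (ε : ℝ), 0 < ε → ∀ (R : ℝ), 0 < R → ∀ (r : ℝ), 0 < r →
        2 ≤ R / r → R / r ≤ 8 →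
      ∀ (u : E2 → EuclideanSpace ℝ (Fin (n + 1))),
        ContDiff ℝ (⊤ : ℕ∞) u →
        (∀ x ∈ ball (0 : E2) (2 * R) \ closedBall (0 : E2) (R / 16),
          -lap u x = ((1 / ε ^ 2) * (1 - ‖u x‖ ^ 2)) • u x) →
        (∀ x ∈ ball (0 : E2) (2 * R) \ closedBall (0 : E2) (R / 16), ‖u x‖ ≤ 1) →
        (∫ x in ball (0 : E2) (2 * R) \ closedBall (0 : E2) (R / 16), eDens ε u x) < δ₀ →
        ∀ σ : ℝ, 0 < σ →
          (∫ x in ball (0 : E2) R \ ball (0 : E2) r,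
              ‖u x‖ * (1 - ‖u x‖ ^ 2) ^ 2 / ε ^ 2)
            ≤ σ * ((∫ x in ball (0 : E2) (2 * R) \ closedBall (0 : E2) (R / 16),
                      eDens ε u x)
                    + C * (R ^ 2 / ε ^ 2) * Real.exp (-(c * R / ε))) ^ 2
              + (C / (σ * R ^ 2)) *
                  ∫ x in ball (0 : E2) R \ ball (0 : E2) r, (1 - ‖u x‖ ^ 2) ^ 2 := by
  obtain ⟨δ₀, hδ, C₀, hC₀, c, hc, key⟩ := core (n + 1)
    (A := ball (0 : E2) 2 \ closedBall (0 : E2) (1 / 16))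
    (K := closedBall (0 : E2) 1 \ ball (0 : E2) (1 / 8))
    (isBounded_ball.subset Set.diff_subset) (isOpen_ball.sdiff isClosed_closedBall)
    ((isCompact_closedBall 0 1).diff isOpen_ball)
    (by
      intro x hx
      simp only [Set.mem_diff, mem_closedBall_zero_iff, mem_ball_zero_iff, not_lt, not_le] at hx ⊢
      exact ⟨by linarith [hx.1], by linarith [hx.2]⟩)
  refine ⟨δ₀, hδ, C₀ + 1, by positivity, c, hc, ?_⟩
  intro ε hε R hR r hr _ hRr u hu hpde hu1 hE σ hσ
  have hud : Differentiable ℝ u := hu.differentiable (by simp)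
  have hRr' : R ≤ 8 * r := by rwa [div_le_iff₀ hr] at hRr
  have hmemA : ∀ x : E2, R • x ∈ ball (0 : E2) (2 * R) \ closedBall (0 : E2) (R / 16) ↔
      x ∈ ball (0 : E2) 2 \ closedBall (0 : E2) (1 / 16) := by
    intro x
    rw [show 2 * R = R * 2 by ring, show R / 16 = R * (1 / 16) by ring, Set.mem_diff, Set.mem_diff,
      mem_ball_scale hR, mem_cball_scale hR]
  have hmemB : ∀ x : E2, R • x ∈ ball (0 : E2) R \ ball (0 : E2) r ↔
      x ∈ ball (0 : E2) 1 \ ball (0 : E2) (r / R) := by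
    intro x
    have h1 := mem_ball_scale (a := 1) hR x
    have h2 := mem_ball_scale (a := r / R) hR x
    rw [mul_one] at h1
    rw [mul_div_cancel₀ r hR.ne'] at h2
    rw [Set.mem_diff, Set.mem_diff, h1, h2]
  have hmA : MeasurableSet (ball (0 : E2) (2 * R) \ closedBall (0 : E2) (R / 16)) :=
    measurableSet_ball.diff measurableSet_closedBall
  have hmA' : MeasurableSet (ball (0 : E2) 2 \ closedBall (0 : E2) (1 / 16)) :=
    measurableSet_ball.diff measurableSet_closedBall
  have hmB : MeasurableSet (ball (0 : E2) R \ ball (0 : E2) r) :=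
    measurableSet_ball.diff measurableSet_ball
  have hmB' : MeasurableSet (ball (0 : E2) 1 \ ball (0 : E2) (r / R)) :=
    measurableSet_ball.diff measurableSet_ball
  have hEint : ∫ x in ball (0 : E2) 2 \ closedBall (0 : E2) (1 / 16),
      eDens (ε / R) (fun y => u (R • y)) x
      = ∫ x in ball (0 : E2) (2 * R) \ closedBall (0 : E2) (R / 16), eDens ε u x := by
    rw [int_scale _ hR _ _ hmA hmA' hmemA, ← integral_const_mul]
    exact integral_congr_ae (Filter.Eventually.of_forall fun x => eDens_scale hud hR hε x)
  have hv : ContDiff ℝ (⊤ : ℕ∞) (fun y => u (R • y)) := hu.comp (contDiff_id.const_smul R)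
  have hk := key (ε / R) (by positivity) (fun y => u (R • y)) hv
    (by
      intro x hx
      have h := hpde (R • x) ((hmemA x).2 hx)
      rw [lap_scale hu, ← smul_neg, h, smul_smul]
      congr 1
      field_simp)
    (fun x hx => hu1 (R • x) ((hmemA x).2 hx))
    (by rw [hEint]; exact hE)
  rw [hEint] at hk
  set E := ∫ x in ball (0 : E2) (2 * R) \ closedBall (0 : E2) (R / 16), eDens ε u x with hEdef
  have hE0 : 0 ≤ E := by
    rw [hEdef]
    refine integral_nonneg fun x => ?_
    unfold eDens gradSqNorm
    positivity
  have hcu : Continuous u := hu.continuous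
  have hYs : ∫ x in ball (0 : E2) R \ ball (0 : E2) r, (1 - ‖u x‖ ^ 2) ^ 2
      ≤ R ^ 2 * ∫ x in closedBall (0 : E2) 1 \ ball (0 : E2) (1 / 8),
          Wf (fun y => u (R • y)) x ^ 2 := by
    rw [int_scale _ hR _ _ hmB hmB' hmemB]
    refine mul_le_mul_of_nonneg_left ?_ (by positivity)
    refine setIntegral_mono_set ?_ ?_ ?_
    · have : Continuous (fun x => Wf (fun y => u (R • y)) x ^ 2) := by
        unfold Wf; fun_prop
      exact this.continuousOn.integrableOn_compact ((isCompact_closedBall 0 1).diff isOpen_ball)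
    · exact Filter.Eventually.of_forall fun x => sq_nonneg _
    · refine Filter.Eventually.of_forall ?_
      intro x hx
      change x ∈ ball (0 : E2) 1 \ ball (0 : E2) (r / R) at hx
      change x ∈ closedBall (0 : E2) 1 \ ball (0 : E2) (1 / 8)
      simp only [Set.mem_diff, mem_closedBall_zero_iff, mem_ball_zero_iff, not_lt] at hx ⊢
      have : 1 / 8 ≤ r / R := by
        rw [div_le_div_iff₀ (by norm_num) hR]; linarith
      exact ⟨hx.1.le, this.trans hx.2⟩
  have hsub : ball (0 : E2) R \ ball (0 : E2) r ⊆ closedBall (0 : E2) R :=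
    Set.diff_subset.trans ball_subset_closedBall
  have hcomp : ∀ g : E2 → ℝ, Continuous g →
      IntegrableOn g (ball (0 : E2) R \ ball (0 : E2) r) volume := fun g hg =>
    (hg.continuousOn.integrableOn_compact (isCompact_closedBall 0 R)).mono_set hsub
  have hlhs : (∫ x in ball (0 : E2) R \ ball (0 : E2) r, ‖u x‖ * (1 - ‖u x‖ ^ 2) ^ 2 / ε ^ 2)
      ≤ (1 / ε ^ 2) * ∫ x in ball (0 : E2) R \ ball (0 : E2) r, (1 - ‖u x‖ ^ 2) ^ 2 := by
    rw [← integral_const_mul]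
    refine setIntegral_mono_on (hcomp _ (by fun_prop)) (hcomp _ (by fun_prop)) hmB ?_
    intro x hx
    have hx1 : ‖u x‖ ≤ 1 := by
      apply hu1
      simp only [Set.mem_diff, mem_closedBall_zero_iff, mem_ball_zero_iff, not_lt, not_le] at hx ⊢
      exact ⟨by linarith [hx.1], by linarith [hx.2]⟩
    rw [one_div, inv_mul_eq_div]
    apply div_le_div_of_nonneg_right _ (by positivity)
    exact mul_le_of_le_one_left (sq_nonneg _) hx1
  have hY0 : 0 ≤ ∫ x in ball (0 : E2) R \ ball (0 : E2) r, (1 - ‖u x‖ ^ 2) ^ 2 :=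
    integral_nonneg fun x => sq_nonneg _
  refine hlhs.trans ?_
  generalize (∫ x in ball (0 : E2) R \ ball (0 : E2) r, (1 - ‖u x‖ ^ 2) ^ 2) = Y at *
  generalize (∫ x in closedBall (0 : E2) 1 \ ball (0 : E2) (1 / 8),
          Wf (fun y => u (R • y)) x ^ 2) = V at *
  have e1 : c / (ε / R) = c * R / ε := by field_simp
  have e2 : 1 / (ε / R) ^ 2 = R ^ 2 / ε ^ 2 := by field_simp
  rw [e1, e2] at hk
  have hq0 : 0 ≤ R ^ 2 / ε ^ 2 * Real.exp (-(c * R / ε)) := by positivity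
  rw [mul_assoc (C₀ + 1)]
  generalize R ^ 2 / ε ^ 2 * Real.exp (-(c * R / ε)) = q at *
  have h1 : R ^ 2 / ε ^ 4 * Y ≤ C₀ * (E + q) ^ 2 := by
    calc R ^ 2 / ε ^ 4 * Y ≤ R ^ 2 / ε ^ 4 * (R ^ 2 * ((ε / R) ^ 4 * (C₀ * (E + q) ^ 2))) := by
          gcongr
          exact hYs.trans (by gcongr)
      _ = C₀ * (E + q) ^ 2 := by field_simp
  have h2 : (E + q) ^ 2 ≤ (E + (C₀ + 1) * q) ^ 2 := by
    gcongr
    nlinarith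
  have h3 : 1 / ε ^ 2 ≤ σ / C₀ * (R ^ 2 / ε ^ 4) + C₀ / (σ * R ^ 2) := by
    have : 0 ≤ (σ * R ^ 2 / ε ^ 2 - C₀ / 2) ^ 2 / (C₀ * σ * R ^ 2) := by positivity
    have e : σ / C₀ * (R ^ 2 / ε ^ 4) + C₀ / (σ * R ^ 2) - 1 / ε ^ 2
       = (σ * R ^ 2 / ε ^ 2 - C₀ / 2) ^ 2 / (C₀ * σ * R ^ 2) + 3 / 4 * (C₀ / (σ * R ^ 2)) := by
      field_simp
      ring
    have : 0 ≤ 3 / 4 * (C₀ / (σ * R ^ 2)) := by positivity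
    linarith
  calc 1 / ε ^ 2 * Y ≤ (σ / C₀ * (R ^ 2 / ε ^ 4) + C₀ / (σ * R ^ 2)) * Y := by gcongr
    _ = σ / C₀ * (R ^ 2 / ε ^ 4 * Y) + C₀ / (σ * R ^ 2) * Y := by ring
    _ ≤ σ / C₀ * (C₀ * (E + q) ^ 2) + (C₀ + 1) / (σ * R ^ 2) * Y := by
        gcongr
        linarith
    _ = σ * (E + q) ^ 2 + (C₀ + 1) / (σ * R ^ 2) * Y := by field_simp
    _ ≤ _ := by gcongr
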